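/- Triangle identity for intersection numbers: for any three continuous paths of Lagrangian subspaces L1, L2, L3 of a real symplectic vector space (E, ω) on [a,b], one has [L1 : L2] + [L2 : L3] + [L3 : L1] = (1/2)( s(L1(a), L2(a), L3(a)) − s(L1(b), L2(b), L3(b)) ). -/

import Mathlib

open LinearMap (BilinForm)

variable {E : Type*} [NormedAddCommGroup E] [NormedSpace ℝ E]

/-- A subspace is Lagrangian iff it equals its symplectic orthogonal. -/
def IsLagrangian (ω : BilinForm ℝ E) (L : Submodule ℝ E) : Prop :=
  LinearMap.BilinForm.orthogonal ω L = L

/-- Maximal dimension of a subspace on which the function `Q` is positive away from `0`. -/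
noncomputable def posIndex {V : Type*} [AddCommGroup V] [Module ℝ V] (Q : V → ℝ) : ℕ :=
  sSup {d : ℕ | ∃ W : Submodule ℝ V, Module.finrank ℝ W = d ∧ ∀ x ∈ W, x ≠ 0 → 0 < Q x}

/-- The quadratic form `Q(L1,L2,L3)` of a triplet of subspaces,
`Q(x1,x2,x3) = ω(x1,x2) + ω(x2,x3) + ω(x3,x1)`. -/
def tripleQ (ω : BilinForm ℝ E) (L1 L2 L3 : Submodule ℝ E) (v : L1 × L2 × L3) : ℝ :=
  ω v.1 v.2.1 + ω v.2.1 v.2.2 + ω v.2.2 v.1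

/-- The signature `s(L1,L2,L3)` of a triplet of subspaces: the signature (number of positive
squares minus number of negative squares in a diagonalization) of `Q(L1,L2,L3)`. -/
noncomputable def tripleSig (ω : BilinForm ℝ E) (L1 L2 L3 : Submodule ℝ E) : ℤ :=
  (posIndex (tripleQ ω L1 L2 L3) : ℤ) - (posIndex (fun v => - tripleQ ω L1 L2 L3 v) : ℤ)

/-- A continuous path of Lagrangian subspaces of `(E, ω)` on the interval `[a,b]`:  a family
`(L t)` of Lagrangian subspaces such that every `t0 ∈ [a,b]` has a neighbourhood `U` in `[a,b]`
on which there is a continuous family of idempotent linear maps of `E` with range `L t`. -/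
structure IsLagrangianPath (ω : BilinForm ℝ E) (a b : ℝ) (L : ℝ → Submodule ℝ E) : Prop where
  lag : ∀ t ∈ Set.Icc a b, IsLagrangian ω (L t)
  locTriv : ∀ t0 ∈ Set.Icc a b, ∃ U ∈ nhdsWithin t0 (Set.Icc a b), U ⊆ Set.Icc a b ∧
    ∃ P : ℝ → E →L[ℝ] E, ContinuousOn P U ∧
      ∀ t ∈ U, (P t).comp (P t) = P t ∧ LinearMap.range (P t : E →ₗ[ℝ] E) = L t

/-- A jointly continuous two-parameter family `(L s t)`, `s ∈ [0,1]`, `t ∈ [a,b]`, of Lagrangian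
subspaces (a homotopy of paths of Lagrangian subspaces). -/
structure IsLagrangianHomotopy (ω : BilinForm ℝ E) (a b : ℝ)
    (L : ℝ → ℝ → Submodule ℝ E) : Prop where
  lag : ∀ s ∈ Set.Icc (0:ℝ) 1, ∀ t ∈ Set.Icc a b, IsLagrangian ω (L s t)
  locTriv : ∀ p ∈ Set.Icc (0:ℝ) 1 ×ˢ Set.Icc a b,
    ∃ U ∈ nhdsWithin p (Set.Icc (0:ℝ) 1 ×ˢ Set.Icc a b),
      U ⊆ Set.Icc (0:ℝ) 1 ×ˢ Set.Icc a b ∧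
      ∃ P : ℝ × ℝ → E →L[ℝ] E, ContinuousOn P U ∧
        ∀ q ∈ U, (P q).comp (P q) = P q ∧ LinearMap.range (P q : E →ₗ[ℝ] E) = L q.1 q.2

/-- Admissible data for a pair of paths of Lagrangian subspaces on `[a,b]`:  a partition
`a = t_0 ≤ t_1 ≤ … ≤ t_k = b` together with Lagrangian subspaces `M_1, …, M_k` such that
`M_ν ∩ L_i(t) = 0` for all `t ∈ [t_{ν-1}, t_ν]`, `i = 1,2`.  (Here `M (ν+1)` plays the role
of `M_{ν+1}` for `0 ≤ ν < k`.) -/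
structure AdmissibleData (ω : BilinForm ℝ E) (a b : ℝ) (L1 L2 : ℝ → Submodule ℝ E) where
  k : ℕ
  kpos : 0 < k
  t : ℕ → ℝ
  M : ℕ → Submodule ℝ E
  ht0 : t 0 = a
  htk : t k = b
  hmono : ∀ ν < k, t ν ≤ t (ν + 1)
  hlag : ∀ ν < k, IsLagrangian ω (M (ν + 1))
  htrans1 : ∀ ν < k, ∀ s ∈ Set.Icc (t ν) (t (ν + 1)), M (ν + 1) ⊓ L1 s = ⊥
  htrans2 : ∀ ν < k, ∀ s ∈ Set.Icc (t ν) (t (ν + 1)), M (ν + 1) ⊓ L2 s = ⊥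

/-- The expression `(1/2) Σ_ν ( s(L1(t_{ν-1}), L2(t_{ν-1}), M_ν) − s(L1(t_ν), L2(t_ν), M_ν) )`
computed from admissible data; by well-definedness this is the intersection number `[L1 : L2]`. -/
noncomputable def dataSum {ω : BilinForm ℝ E} {a b : ℝ} {L1 L2 : ℝ → Submodule ℝ E}
    (D : AdmissibleData ω a b L1 L2) : ℝ :=
  (1 / 2 : ℝ) * ∑ ν ∈ Finset.range D.k,
    ((tripleSig ω (L1 (D.t ν)) (L2 (D.t ν)) (D.M (ν + 1)) : ℝ)
      - (tripleSig ω (L1 (D.t (ν + 1))) (L2 (D.t (ν + 1))) (D.M (ν + 1)) : ℝ))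

/-- A continuous path of symplectic automorphisms of `(E, ω)` on `[a,b]`. -/
structure IsSymplecticPath (ω : BilinForm ℝ E) (a b : ℝ) (A : ℝ → E →L[ℝ] E) : Prop where
  bij : ∀ t ∈ Set.Icc a b, Function.Bijective (A t)
  symp : ∀ t ∈ Set.Icc a b, ∀ x y, ω (A t x) (A t y) = ω x y
  cont : ContinuousOn A (Set.Icc a b)

/-- The symplectic form of `E × E⁻`: `((x1,x2),(y1,y2)) ↦ ω(x1,y1) − ω(x2,y2)`. -/
noncomputable def prodNegForm (ω : BilinForm ℝ E) : BilinForm ℝ (E × E) :=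
  LinearMap.mk₂ ℝ (fun x y => ω x.1 y.1 - ω x.2 y.2)
    (fun x x' y => by simp only [Prod.fst_add, Prod.snd_add, map_add, LinearMap.add_apply]; ring)
    (fun c x y => by
      simp only [Prod.smul_fst, Prod.smul_snd, map_smul, LinearMap.smul_apply, smul_eq_mul]; ring)
    (fun x y y' => by simp only [Prod.fst_add, Prod.snd_add, map_add]; ring)
    (fun c x y => by simp only [Prod.smul_fst, Prod.smul_snd, map_smul, smul_eq_mul]; ring)

/-- The graph `Γ_A = {(A x, x)}` of an endomorphism, as a subspace of `E × E`. -/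
def graphSub (A : E →L[ℝ] E) : Submodule ℝ (E × E) :=
  LinearMap.range ((A : E →ₗ[ℝ] E).prod LinearMap.id)

/-- The diagonal `Δ = {(x, x)}` in `E × E`. -/
def diagSub : Submodule ℝ (E × E) :=
  LinearMap.range ((LinearMap.id : E →ₗ[ℝ] E).prod LinearMap.id)

open Filter Topology Module

/-- The signature of a real quadratic form. -/
noncomputable def formSig {V : Type*} [AddCommGroup V] [Module ℝ V] (Q : QuadraticForm ℝ V) : ℤ :=
  (sigPos Q : ℤ) - (sigNeg Q : ℤ)

theorem posIndex_eq_sigPos {V : Type*} [AddCommGroup V] [Module ℝ V] [FiniteDimensional ℝ V]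
    (Q : QuadraticForm ℝ V) : posIndex Q = sigPos Q := by
  rw [← (sigPos_isGreatest Q).csSup_eq]
  simp [posIndex, QuadraticMap.PosDef]

theorem formSig_eq_of_equivalent {V V' : Type*} [AddCommGroup V] [Module ℝ V] [AddCommGroup V']
    [Module ℝ V'] {Q : QuadraticForm ℝ V} {Q' : QuadraticForm ℝ V'} (h : Q.Equivalent Q') :
    formSig Q = formSig Q' := by
  rw [formSig, formSig, h.sigPos_eq, h.sigNeg_eq]

theorem finrank_submodule_prod {V V' : Type*} [AddCommGroup V] [Module ℝ V] [AddCommGroup V']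
    [Module ℝ V'] [FiniteDimensional ℝ V] [FiniteDimensional ℝ V']
    (W : Submodule ℝ V) (W' : Submodule ℝ V') :
    finrank ℝ (W.prod W') = finrank ℝ W + finrank ℝ W' := by
  have h := LinearMap.finrank_range_of_inj (f := W.subtype.prodMap W'.subtype)
    (W.injective_subtype.prodMap W'.injective_subtype)
  rwa [LinearMap.range_prodMap, W.range_subtype, W'.range_subtype, finrank_prod] at h

theorem sigPos_add_sigPos_le_prod {V V' : Type*} [AddCommGroup V] [Module ℝ V] [AddCommGroup V']
    [Module ℝ V'] [FiniteDimensional ℝ V] [FiniteDimensional ℝ V']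
    (Q : QuadraticForm ℝ V) (Q' : QuadraticForm ℝ V') :
    sigPos Q + sigPos Q' ≤ sigPos (QuadraticMap.prod Q Q') := by
  obtain ⟨W, hW, hpos⟩ := exists_finrank_eq_sigPos_and_posDef Q
  obtain ⟨W', hW', hpos'⟩ := exists_finrank_eq_sigPos_and_posDef Q'
  rw [← hW, ← hW', ← finrank_submodule_prod]
  refine le_sigPos_of_posDef _ ?_
  rintro ⟨⟨x, y⟩, hx, hy⟩ hxy
  have hx' : x ≠ 0 → 0 < Q x := fun h0 => hpos ⟨x, hx⟩ (by simpa using h0)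
  have hy' : y ≠ 0 → 0 < Q' y := fun h0 => hpos' ⟨y, hy⟩ (by simpa using h0)
  simp only [QuadraticMap.restrict_apply, QuadraticMap.prod_apply]
  by_cases hx0 : x = 0 <;> by_cases hy0 : y = 0
  · simp [hx0, hy0] at hxy
  · simpa [hx0] using hy' hy0
  · simpa [hy0] using hx' hx0
  · exact add_pos (hx' hx0) (hy' hy0)

theorem formSig_prod {V V' : Type*} [AddCommGroup V] [Module ℝ V] [AddCommGroup V']
    [Module ℝ V'] [FiniteDimensional ℝ V] [FiniteDimensional ℝ V']
    (Q : QuadraticForm ℝ V) (Q' : QuadraticForm ℝ V') :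
    formSig (QuadraticMap.prod Q Q') = formSig Q + formSig Q' := by
  have hp := sigPos_add_sigPos_le_prod Q Q'
  have hn : sigNeg Q + sigNeg Q' ≤ sigNeg (QuadraticMap.prod Q Q') := by
    refine (sigPos_add_sigPos_le_prod (-Q) (-Q')).trans_eq ?_
    rw [← sigPos_neg]
    congr 1
    ext x
    simp [add_comm]
  have hr : finrank ℝ Q.radical + finrank ℝ Q'.radical ≤
      finrank ℝ (QuadraticMap.prod Q Q').radical := by
    rw [← finrank_submodule_prod]
    refine Submodule.finrank_mono fun x hx => ?_
    obtain ⟨hx, hx'⟩ := hx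
    simp only [SetLike.mem_coe, QuadraticMap.mem_radical_iff'] at hx hx' ⊢
    simp [hx.1, hx'.1, hx.2, hx'.2]
  have h := QuadraticForm.sigPos_add_sigNeg_add_radical (Q := Q)
  have h' := QuadraticForm.sigPos_add_sigNeg_add_radical (Q := Q')
  have h'' := QuadraticForm.sigPos_add_sigNeg_add_radical (Q := QuadraticMap.prod Q Q')
  rw [finrank_prod] at h''
  simp only [formSig]
  lia

/-- The quadratic form `x ↦ ω (p x) (q x)` on a subspace `N`. -/
noncomputable def relForm (ω : BilinForm ℝ E) (N : Submodule ℝ E) (p q : E →L[ℝ] E) :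
    QuadraticForm ℝ N :=
  LinearMap.BilinMap.toQuadraticMap
    (ω.compl₁₂ ((p : E →ₗ[ℝ] E) ∘ₗ N.subtype) ((q : E →ₗ[ℝ] E) ∘ₗ N.subtype))

@[simp]
theorem relForm_apply (ω : BilinForm ℝ E) (N : Submodule ℝ E) (p q : E →L[ℝ] E) (x : N) :
    relForm ω N p q x = ω (p x) (q x) := rfl

theorem eventually_forall_pos [FiniteDimensional ℝ E] (ω : BilinForm ℝ E) (V : Submodule ℝ E)
    (p q : E →L[ℝ] E) (h : ∀ x ∈ V, x ≠ 0 → 0 < ω (p x) (q x)) :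
    ∀ᶠ r : (E →L[ℝ] E) × (E →L[ℝ] E) in 𝓝 (p, q), ∀ x ∈ V, x ≠ 0 → 0 < ω (r.1 x) (r.2 x) := by
  have hK : IsCompact (Metric.sphere (0 : E) 1 ∩ V) :=
    have := FiniteDimensional.proper ℝ E
    (isCompact_sphere 0 1).inter_right V.closed_of_finiteDimensional
  have hcont : Continuous fun z : ((E →L[ℝ] E) × (E →L[ℝ] E)) × E => ω (z.1.1 z.2) (z.1.2 z.2) := by
    simp only [← LinearMap.toContinuousBilinearMap_apply]
    fun_prop
  have := hK.eventually_forall_of_forall_eventually (x₀ := (p, q))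
    (P := fun r x => 0 < ω (r.1 x) (r.2 x)) fun y hy =>
      hcont.continuousAt.eventually_const_lt (h y hy.2 fun h0 => by simp [h0] at hy)
  filter_upwards [this] with r hr x hx hx0
  have := hr (‖x‖⁻¹ • x) ⟨by simp [norm_smul, hx0], V.smul_mem _ hx⟩
  simp only [map_smul, LinearMap.smul_apply, smul_eq_mul] at this
  have hn : 0 < ‖x‖⁻¹ := by positivity
  exact pos_of_mul_pos_right (pos_of_mul_pos_right this hn.le) hn.le

theorem eventually_sigPos_le [FiniteDimensional ℝ E] (ω : BilinForm ℝ E) (N : Submodule ℝ E)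
    (p q : E →L[ℝ] E) :
    ∀ᶠ r : (E →L[ℝ] E) × (E →L[ℝ] E) in 𝓝 (p, q),
      sigPos (relForm ω N p q) ≤ sigPos (relForm ω N r.1 r.2) := by
  obtain ⟨W, hW, hpos⟩ := exists_finrank_eq_sigPos_and_posDef (relForm ω N p q)
  rw [← hW]
  filter_upwards [eventually_forall_pos ω (W.map N.subtype) p q (by
    rintro _ ⟨x, hx, rfl⟩ hx0
    exact hpos ⟨x, hx⟩ (by simpa using hx0))] with r hr
  refine le_sigPos_of_posDef _ fun x hx => ?_
  exact hr x.1 ⟨x.1, x.2, rfl⟩ (by simpa using hx)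

theorem eventually_formSig_eq [FiniteDimensional ℝ E] (ω : BilinForm ℝ E) (N : Submodule ℝ E)
    (p q : E →L[ℝ] E) (h : (relForm ω N p q).radical = ⊥) :
    ∀ᶠ r : (E →L[ℝ] E) × (E →L[ℝ] E) in 𝓝 (p, q),
      formSig (relForm ω N r.1 r.2) = formSig (relForm ω N p q) := by
  have hneg (p q : E →L[ℝ] E) : sigNeg (relForm ω N p q) = sigPos (relForm (-ω) N p q) := by
    rw [← sigPos_neg]
    congr 1
  filter_upwards [eventually_sigPos_le ω N p q, eventually_sigPos_le (-ω) N p q] with r h1 h2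
  have h3 := QuadraticForm.sigPos_add_sigNeg_add_radical (Q := relForm ω N p q)
  have h4 := QuadraticForm.sigPos_add_sigNeg_add_radical (Q := relForm ω N r.1 r.2)
  rw [h, finrank_bot] at h3
  rw [← hneg, ← hneg] at h2
  simp only [formSig]
  lia

theorem IsLagrangian.apply_eq_zero {ω : BilinForm ℝ E} {L : Submodule ℝ E} (h : IsLagrangian ω L)
    {x y : E} (hx : x ∈ L) (hy : y ∈ L) : ω x y = 0 := by
  rw [← h] at hy
  exact LinearMap.BilinForm.mem_orthogonal_iff.mp hy x hx

theorem IsLagrangian.two_mul_finrank [FiniteDimensional ℝ E] {ω : BilinForm ℝ E}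
    (hnd : LinearMap.BilinForm.Nondegenerate ω) {L : Submodule ℝ E} (h : IsLagrangian ω L) :
    2 * finrank ℝ L = finrank ℝ E := by
  have h1 := LinearMap.BilinForm.finrank_orthogonal hnd L
  rw [h] at h1
  have := L.finrank_le
  lia

theorem IsLagrangian.isCompl [FiniteDimensional ℝ E] {ω : BilinForm ℝ E}
    (hnd : LinearMap.BilinForm.Nondegenerate ω) {M L : Submodule ℝ E} (hM : IsLagrangian ω M)
    (hL : IsLagrangian ω L) (h : M ⊓ L = ⊥) : IsCompl M L := by
  have h1 := hM.two_mul_finrank hnd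
  have h2 := hL.two_mul_finrank hnd
  have h3 := Submodule.finrank_sup_add_finrank_inf_eq M L
  rw [h, finrank_bot] at h3
  exact ⟨disjoint_iff.mpr h,
    codisjoint_iff.mpr (Submodule.eq_top_of_finrank_eq (by lia))⟩

theorem exists_isLagrangian_inf_eq_bot [FiniteDimensional ℝ E] {ω : BilinForm ℝ E}
    (halt : LinearMap.IsAlt ω) (hnd : LinearMap.BilinForm.Nondegenerate ω)
    {ι : Type*} [Finite ι] {S : ι → Submodule ℝ E} (hS : ∀ i, IsLagrangian ω (S i)) :
    ∃ M, IsLagrangian ω M ∧ ∀ i, M ⊓ S i = ⊥ := by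
  have hrefl : LinearMap.BilinForm.IsRefl ω := halt.isRefl
  obtain ⟨M, ⟨hiso, hinf⟩, hmax⟩ := exists_maximal_of_wellFoundedGT
    (fun W : Submodule ℝ E => W ≤ LinearMap.BilinForm.orthogonal ω W ∧ ∀ i, W ⊓ S i = ⊥)
    ⟨⊥, by simp⟩
  refine ⟨M, ?_, hinf⟩
  by_contra hne
  have hlt : M < LinearMap.BilinForm.orthogonal ω M := lt_of_le_of_ne hiso (Ne.symm hne)
  have hproper (i : ι) : ¬ LinearMap.BilinForm.orthogonal ω M ≤ M ⊔ S i := by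
    intro hle
    have h1 : S i ⊓ LinearMap.BilinForm.orthogonal ω M ≤ M := by
      have := LinearMap.BilinForm.orthogonal_le (B := ω) hle
      rw [LinearMap.BilinForm.orthogonal_orthogonal hnd hrefl] at this
      refine le_trans ?_ this
      intro x hx
      rw [LinearMap.BilinForm.mem_orthogonal_iff]
      intro y hy
      obtain ⟨m, hm, s, hs, rfl⟩ := Submodule.mem_sup.mp hy
      have h2 : ω m x = 0 := LinearMap.BilinForm.mem_orthogonal_iff.mp hx.2 m hm
      have h3 : ω s x = 0 := (hS i).apply_eq_zero hs hx.1
      simp [h2, h3]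
    refine hlt.not_ge fun x hx => ?_
    obtain ⟨m, hm, s, hs, rfl⟩ := Submodule.mem_sup.mp (hle hx)
    have h2 : s ∈ LinearMap.BilinForm.orthogonal ω M := by
      simpa using Submodule.sub_mem _ hx (hiso hm)
    exact M.add_mem hm (h1 ⟨hs, h2⟩)
  obtain ⟨x, hx, hxM⟩ : ∃ x ∈ LinearMap.BilinForm.orthogonal ω M, ∀ o : Option ι,
      x ∉ o.elim M fun i => M ⊔ S i := by
    by_contra! hcov
    obtain ⟨o, ho⟩ := Subspace.exists_eq_top_of_iUnion_eq_univ (k := ℝ)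
      (p := fun o : Option ι => (o.elim M fun i => M ⊔ S i).comap
        (LinearMap.BilinForm.orthogonal ω M).subtype) (by
        ext x
        simpa using hcov x.1 x.2)
    rw [Submodule.comap_subtype_eq_top] at ho
    cases o with
    | none => exact hlt.not_ge ho
    | some i => exact hproper i ho
  have hxx : ω x x = 0 := halt x
  have hMx (m : E) (hm : m ∈ M) : ω m x = 0 := LinearMap.BilinForm.mem_orthogonal_iff.mp hx m hm
  have hxm (m : E) (hm : m ∈ M) : ω x m = 0 := hrefl _ _ (hMx m hm)
  have hMM (m m' : E) (hm : m ∈ M) (hm' : m' ∈ M) : ω m m' = 0 :=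
    LinearMap.BilinForm.mem_orthogonal_iff.mp (hiso hm') m hm
  refine hxM none (hmax (y := M ⊔ ℝ ∙ x) ⟨?_, fun i => ?_⟩ le_sup_left
    (Submodule.mem_sup_right (Submodule.mem_span_singleton_self x)))
  · intro y hy
    rw [LinearMap.BilinForm.mem_orthogonal_iff]
    intro z hz
    obtain ⟨m, hm, _, hc, rfl⟩ := Submodule.mem_sup.mp hy
    obtain ⟨c, rfl⟩ := Submodule.mem_span_singleton.mp hc
    obtain ⟨m', hm', _, hc', rfl⟩ := Submodule.mem_sup.mp hz
    obtain ⟨c', rfl⟩ := Submodule.mem_span_singleton.mp hc'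
    simp [hxx, hMx m' hm', hxm m hm, hMM m' m hm' hm]
  · rw [Submodule.eq_bot_iff]
    rintro y ⟨hy, hyS⟩
    obtain ⟨m, hm, _, hc, rfl⟩ := Submodule.mem_sup.mp hy
    obtain ⟨c, rfl⟩ := Submodule.mem_span_singleton.mp hc
    have hcx : c • x ∈ M ⊔ S i := by
      have := Submodule.sub_mem _ (Submodule.mem_sup_right hyS : m + c • x ∈ M ⊔ S i)
        (Submodule.mem_sup_left hm)
      simpa using this
    obtain rfl : c = 0 := by
      by_contra hc0
      exact hxM (some i) ((Submodule.smul_mem_iff _ hc0).mp hcx)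
    have : m + (0 : ℝ) • x ∈ M ⊓ S i := ⟨by simpa using hm, hyS⟩
    rwa [hinf i] at this

/-- `p` is the projection of `E` onto `L` along `M`. -/
structure IsProjAlong (M L : Submodule ℝ E) (p : E →L[ℝ] E) : Prop where
  mem : ∀ x, p x ∈ L
  sub_mem : ∀ x, x - p x ∈ M
  apply_of_mem : ∀ x ∈ L, p x = x
  apply_eq_zero : ∀ x ∈ M, p x = 0

theorem exists_isProjAlong [FiniteDimensional ℝ E] {M L : Submodule ℝ E} (h : IsCompl M L) :
    ∃ p, IsProjAlong M L p := by
  have hfix (x : E) (hx : x ∈ L) : L.projection M h.symm x = x :=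
    Submodule.projection_apply_of_mem_left h.symm hx
  have hzero (x : E) : L.projection M h.symm x = 0 ↔ x ∈ M := by
    rw [← Submodule.coe_projectionOnto_apply, ZeroMemClass.coe_eq_zero,
      Submodule.projectionOnto_apply_eq_zero_iff]
  have hmem := Submodule.projection_apply_mem h.symm
  refine ⟨LinearMap.toContinuousLinearMap (L.projection M h.symm), hmem, fun x => ?_, hfix,
    fun x hx => (hzero x).mpr hx⟩
  rw [← hzero, map_sub]
  exact sub_eq_zero.mpr (hfix _ (hmem x)).symm

theorem IsProjAlong.eq_zero {M L N : Submodule ℝ E} {p : E →L[ℝ] E} (h : IsProjAlong M L p)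
    (hN : IsCompl M N) {x : E} (hx : x ∈ N) (hpx : p x = 0) : x = 0 := by
  have := h.sub_mem x
  rw [hpx, sub_zero] at this
  exact Submodule.disjoint_def.mp hN.disjoint x this hx

/-- The projection onto `L` along `M` identifies any complement of `M` with `L`. -/
noncomputable def IsProjAlong.equiv {M L N : Submodule ℝ E} {p : E →L[ℝ] E}
    (h : IsProjAlong M L p) (hN : IsCompl M N) : N ≃ₗ[ℝ] L :=
  LinearEquiv.ofBijective (((p : E →ₗ[ℝ] E) ∘ₗ N.subtype).codRestrict L fun x => h.mem x) <| by
    refine ⟨(injective_iff_map_eq_zero _).mpr fun x hx => ?_, fun y => ?_⟩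
    · exact Subtype.ext (h.eq_zero hN x.2 (congrArg Subtype.val hx))
    · obtain ⟨m, hm, n, hn, hmn⟩ := Submodule.mem_sup.mp
        (hN.sup_eq_top.ge (Submodule.mem_top (x := (y : E))))
      refine ⟨⟨n, hn⟩, Subtype.ext ?_⟩
      have := h.apply_of_mem y y.2
      rw [← hmn, map_add, h.apply_eq_zero m hm, zero_add, hmn] at this
      exact this

@[simp]
theorem IsProjAlong.coe_equiv_apply {M L N : Submodule ℝ E} {p : E →L[ℝ] E}
    (h : IsProjAlong M L p) (hN : IsCompl M N) (x : N) : (h.equiv hN x : E) = p x := rfl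

section ProjPair

variable {ω : BilinForm ℝ E} {M A B : Submodule ℝ E} {p q : E →L[ℝ] E}

theorem IsProjAlong.apply_apply (hM : IsLagrangian ω M) (hA : IsLagrangian ω A)
    (hp : IsProjAlong M A p) (hq : IsProjAlong M B q) (x y : E) :
    ω (p x) (q y) = ω x (q y) - ω x (p y) := by
  have h1 := hA.apply_eq_zero (hp.mem x) (hp.mem y)
  have h2 := hM.apply_eq_zero (hp.sub_mem x) (Submodule.sub_mem _ (hp.sub_mem y) (hq.sub_mem y))
  simp only [map_sub, LinearMap.sub_apply] at h2
  linarith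

theorem IsProjAlong.apply_apply_comm (halt : LinearMap.IsAlt ω) (hM : IsLagrangian ω M)
    (hA : IsLagrangian ω A) (hB : IsLagrangian ω B)
    (hp : IsProjAlong M A p) (hq : IsProjAlong M B q) (x y : E) :
    ω (p x) (q y) = ω (p y) (q x) := by
  have h1 := hp.apply_apply hM hA hq x y
  have h2 := hq.apply_apply hM hB hp x y
  have h3 := halt.neg (q x) (p y)
  linarith

theorem radical_relForm_eq_bot (halt : LinearMap.IsAlt ω)
    (hnd : LinearMap.BilinForm.Nondegenerate ω) (hM : IsLagrangian ω M)
    (hA : IsLagrangian ω A) (hB : IsLagrangian ω B) (hp : IsProjAlong M A p)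
    (hq : IsProjAlong M B q) (hAB : A ⊓ B = ⊥) {N : Submodule ℝ E} (hN : IsCompl M N) :
    (relForm ω N p q).radical = ⊥ := by
  rw [Submodule.eq_bot_iff]
  intro y hy
  have hpol (x : N) : ω (p x) (q y) = 0 := by
    have h1 := (QuadraticMap.mem_radical_iff'.mp hy).1
    have h2 := (QuadraticMap.mem_radical_iff'.mp hy).2 x
    simp only [relForm_apply, Submodule.coe_add, map_add, LinearMap.add_apply] at h1 h2
    have h3 := hp.apply_apply_comm halt hM hA hB hq x y
    linarith
  have hzero (x : E) : ω x (q y - p y) = 0 := by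
    obtain ⟨m, hm, n, hn, rfl⟩ := Submodule.mem_sup.mp
      (hN.sup_eq_top.ge (Submodule.mem_top (x := x)))
    have h1 := hpol ⟨n, hn⟩
    rw [hp.apply_apply hM hA hq, ← map_sub] at h1
    have h2 := hM.apply_eq_zero hm (Submodule.sub_mem _ (hp.sub_mem y) (hq.sub_mem y))
    rw [sub_sub_sub_cancel_left] at h2
    rw [map_add, LinearMap.add_apply, h1, h2, add_zero]
  have hpq : q y = p y := sub_eq_zero.mp (hnd.2 _ hzero)
  have hmem : p y ∈ A ⊓ B := ⟨hp.mem y, hpq ▸ hq.mem y⟩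
  rw [hAB, Submodule.mem_bot] at hmem
  exact Subtype.ext (hp.eq_zero hN y.2 hmem)

end ProjPair

/-- The form `tripleQ` as a quadratic form. -/
noncomputable def tripleForm (ω : BilinForm ℝ E) (A B C : Submodule ℝ E) :
    QuadraticForm ℝ (A × B × C) :=
  LinearMap.BilinMap.toQuadraticMap
    (ω.compl₁₂ (A.subtype ∘ₗ LinearMap.fst ℝ A (B × C))
        (B.subtype ∘ₗ LinearMap.fst ℝ B C ∘ₗ LinearMap.snd ℝ A (B × C)) +
      ω.compl₁₂ (B.subtype ∘ₗ LinearMap.fst ℝ B C ∘ₗ LinearMap.snd ℝ A (B × C))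
        (C.subtype ∘ₗ LinearMap.snd ℝ B C ∘ₗ LinearMap.snd ℝ A (B × C)) +
      ω.compl₁₂ (C.subtype ∘ₗ LinearMap.snd ℝ B C ∘ₗ LinearMap.snd ℝ A (B × C))
        (A.subtype ∘ₗ LinearMap.fst ℝ A (B × C)))

theorem tripleForm_apply (ω : BilinForm ℝ E) (A B C : Submodule ℝ E) (v : A × B × C) :
    tripleForm ω A B C v = tripleQ ω A B C v := rfl

theorem tripleSig_eq_formSig [FiniteDimensional ℝ E] (ω : BilinForm ℝ E) (A B C : Submodule ℝ E) :
    tripleSig ω A B C = formSig (tripleForm ω A B C) := by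
  rw [formSig, ← posIndex_eq_sigPos, ← sigPos_neg, ← posIndex_eq_sigPos]
  rfl

/-- The linear automorphism `(x, y, z) ↦ (y + z, z + x, x + y)`. -/
noncomputable def pairSumEquiv (V : Type*) [AddCommGroup V] [Module ℝ V] :
    (V × V × V) ≃ₗ[ℝ] (V × V × V) where
  toFun v := (v.2.1 + v.2.2, v.2.2 + v.1, v.1 + v.2.1)
  invFun v := ((1 / 2 : ℝ) • (v.2.1 + v.2.2 - v.1), (1 / 2 : ℝ) • (v.2.2 + v.1 - v.2.1),
    (1 / 2 : ℝ) • (v.1 + v.2.1 - v.2.2))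
  map_add' v w := by ext <;> simp <;> module
  map_smul' c v := by ext <;> simp
  left_inv v := by ext <;> simp <;> module
  right_inv v := by ext <;> simp <;> module

theorem tripleSig_eq_add [FiniteDimensional ℝ E] {ω : BilinForm ℝ E} (halt : LinearMap.IsAlt ω)
    {M A B C N : Submodule ℝ E} (hM : IsLagrangian ω M) (hA : IsLagrangian ω A)
    (hB : IsLagrangian ω B) (hC : IsLagrangian ω C) (hN : IsCompl M N) {p q r : E →L[ℝ] E}
    (hp : IsProjAlong M A p) (hq : IsProjAlong M B q) (hr : IsProjAlong M C r) :
    tripleSig ω A B C =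
      formSig (relForm ω N p q) + formSig (relForm ω N q r) + formSig (relForm ω N r p) := by
  rw [tripleSig_eq_formSig, ← formSig_eq_of_equivalent (Q := QuadraticMap.prod (relForm ω N q r)
    (QuadraticMap.prod (relForm ω N r p) (relForm ω N p q))), formSig_prod, formSig_prod]
  · ring
  refine ⟨⟨(pairSumEquiv N).trans ((hp.equiv hN).prodCongr ((hq.equiv hN).prodCongr (hr.equiv hN))),
    fun v => ?_⟩⟩
  obtain ⟨x, y, z⟩ := v
  change ω (p (y + z : N)) (q (z + x : N)) + ω (q (z + x : N)) (r (x + y : N)) +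
    ω (r (x + y : N)) (p (y + z : N)) =
      ω (q x) (r x) + (ω (r y) (p y) + ω (p z) (q z))
  simp only [Submodule.coe_add, map_add, LinearMap.add_apply]
  have hcyc (x y : E) : ω (p x) (q y) + ω (q x) (r y) + ω (r x) (p y) = 0 := by
    rw [hp.apply_apply hM hA hq, hq.apply_apply hM hB hr, hr.apply_apply hM hC hp]
    ring
  have h1 := hcyc x y
  have h2 := hcyc y z
  have h3 := hcyc z x
  have hpq := hp.apply_apply_comm halt hM hA hB hq
  have hqr := hq.apply_apply_comm halt hM hB hC hr
  have hrp := hr.apply_apply_comm halt hM hC hA hp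
  linarith [hpq x y, hpq y z, hpq z x, hqr x y, hqr y z, hqr z x, hrp x y, hrp y z, hrp z x]

theorem IsLagrangianPath.exists_isProjAlong [FiniteDimensional ℝ E] {ω : BilinForm ℝ E}
    (hnd : LinearMap.BilinForm.Nondegenerate ω) {a b t₀ : ℝ} {L : ℝ → Submodule ℝ E}
    (hL : IsLagrangianPath ω a b L) (ht₀ : t₀ ∈ Set.Icc a b) {M : Submodule ℝ E}
    (hM : IsLagrangian ω M) (hML : M ⊓ L t₀ = ⊥) :
    ∃ p : ℝ → E →L[ℝ] E, Tendsto p (𝓝[Set.Icc a b] t₀) (𝓝 (p t₀)) ∧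
      ∀ᶠ t in 𝓝[Set.Icc a b] t₀, IsProjAlong M (L t) (p t) := by
  have : CompleteSpace E := FiniteDimensional.complete ℝ E
  obtain ⟨p₀, hp₀⟩ := _root_.exists_isProjAlong (hM.isCompl hnd (hL.lag t₀ ht₀) hML)
  obtain ⟨U, hU, hUsub, P, hPc, hP⟩ := hL.locTriv t₀ ht₀
  set T : ℝ → E →L[ℝ] E := fun t => P t * p₀ + (1 - p₀)
  have hTapp (t : ℝ) (x : E) : T t x = P t (p₀ x) + (x - p₀ x) := rfl
  have ht₀U : t₀ ∈ U := mem_of_mem_nhdsWithin ht₀ hU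
  have hfix (t : ℝ) (ht : t ∈ U) (x : E) (hx : x ∈ L t) : P t x = x := by
    rw [← (hP t ht).2] at hx
    obtain ⟨y, rfl⟩ := hx
    exact congrArg (fun f : E →L[ℝ] E => f y) (hP t ht).1
  have hPmem (t : ℝ) (ht : t ∈ U) (x : E) : P t x ∈ L t := by
    rw [← (hP t ht).2]
    exact ⟨x, rfl⟩
  have hT₀ : T t₀ = 1 := by
    ext x
    rw [hTapp, hfix t₀ ht₀U _ (hp₀.mem x)]
    simp
  have hTc : Tendsto T (𝓝[Set.Icc a b] t₀) (𝓝 (T t₀)) := by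
    have h1 : Tendsto P (𝓝[Set.Icc a b] t₀) (𝓝 (P t₀)) :=
      (hPc t₀ ht₀U).mono_left (nhdsWithin_le_iff.mpr hU)
    exact (h1.mul_const p₀).add_const _
  have hinv : Tendsto (fun t => Ring.inverse (T t)) (𝓝[Set.Icc a b] t₀)
      (𝓝 (Ring.inverse (T t₀))) := by
    have := NormedRing.inverse_continuousAt (1 : (E →L[ℝ] E)ˣ)
    rw [Units.val_one, ← hT₀] at this
    exact this.tendsto.comp hTc
  have hunit : ∀ᶠ t in 𝓝[Set.Icc a b] t₀, IsUnit (T t) := by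
    have := Units.nhds (1 : (E →L[ℝ] E)ˣ)
    rw [Units.val_one, ← hT₀] at this
    exact hTc this
  refine ⟨fun t => T t * p₀ * Ring.inverse (T t), (hTc.mul_const p₀).mul hinv, ?_⟩
  filter_upwards [hU, hunit] with t ht hu
  have hr (x : E) : T t (Ring.inverse (T t) x) = x :=
    congrArg (fun f : E →L[ℝ] E => f x) (Ring.mul_inverse_cancel _ hu)
  have hl (x : E) : Ring.inverse (T t) (T t x) = x :=
    congrArg (fun f : E →L[ℝ] E => f x) (Ring.inverse_mul_cancel _ hu)
  have happ (x : E) : (T t * p₀ * Ring.inverse (T t)) x = T t (p₀ (Ring.inverse (T t) x)) := rfl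
  have hTp (x : E) : T t (p₀ x) = P t (p₀ x) := by
    rw [hTapp, hp₀.apply_of_mem _ (hp₀.mem x), sub_self, add_zero]
  have hTM (x : E) (hx : x ∈ M) : T t x = x := by
    rw [hTapp, hp₀.apply_eq_zero x hx, map_zero, zero_add, sub_zero]
  have hmap : (L t₀).map (T t : E →ₗ[ℝ] E) = L t := by
    refine Submodule.eq_of_le_of_finrank_eq ?_ ?_
    · rintro _ ⟨x, hx, rfl⟩
      have := hTp x
      rw [hp₀.apply_of_mem x hx] at this
      change T t x ∈ L t
      rw [this]
      exact hPmem t ht x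
    · have h1 := (hL.lag t₀ ht₀).two_mul_finrank hnd
      have h2 := (hL.lag t (hUsub ht)).two_mul_finrank hnd
      have h3 : finrank ℝ ((L t₀).map (T t : E →ₗ[ℝ] E)) = finrank ℝ (L t₀) :=
        (Submodule.equivMapOfInjective (T t : E →ₗ[ℝ] E)
          (Function.LeftInverse.injective hl) (L t₀)).finrank_eq.symm
      lia
  constructor
  · intro x
    rw [happ, hTp]
    exact hPmem t ht _
  · intro x
    rw [happ]
    nth_rw 1 [← hr x]
    rw [← map_sub, hTM _ (hp₀.sub_mem _)]
    exact hp₀.sub_mem _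
  · intro x hx
    rw [← hmap] at hx
    obtain ⟨y, hy, rfl⟩ := hx
    change (T t * p₀ * Ring.inverse (T t)) (T t y) = T t y
    rw [happ, hl, hp₀.apply_of_mem y hy]
  · intro x hx
    rw [happ]
    nth_rw 1 [← hTM x hx]
    rw [hl, hp₀.apply_eq_zero x hx, map_zero]

/-- Two Lagrangian paths both transverse to a fixed Lagrangian `K` at `t₀`: the difference between
`s(L₁(t), L₂(t), K)` and the signature of `L₁(t)` relative to `L₂(t)` is locally constant. -/
theorem eventually_tripleSig_sub_eq [FiniteDimensional ℝ E] {ω : BilinForm ℝ E}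
    (halt : LinearMap.IsAlt ω) (hnd : LinearMap.BilinForm.Nondegenerate ω)
    {a b t₀ : ℝ} {L1 L2 : ℝ → Submodule ℝ E} (h1 : IsLagrangianPath ω a b L1)
    (h2 : IsLagrangianPath ω a b L2) (ht₀ : t₀ ∈ Set.Icc a b) {M N K : Submodule ℝ E}
    (hM : IsLagrangian ω M) (hN : IsCompl M N) (hK : IsLagrangian ω K) (hMK : M ⊓ K = ⊥)
    (hK1 : K ⊓ L1 t₀ = ⊥) (hK2 : K ⊓ L2 t₀ = ⊥) {p q : ℝ → E →L[ℝ] E}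
    (hpc : Tendsto p (𝓝[Set.Icc a b] t₀) (𝓝 (p t₀)))
    (hqc : Tendsto q (𝓝[Set.Icc a b] t₀) (𝓝 (q t₀)))
    (hp : ∀ᶠ t in 𝓝[Set.Icc a b] t₀, IsProjAlong M (L1 t) (p t))
    (hq : ∀ᶠ t in 𝓝[Set.Icc a b] t₀, IsProjAlong M (L2 t) (q t)) :
    ∀ᶠ t in 𝓝[Set.Icc a b] t₀,
      tripleSig ω (L1 t) (L2 t) K - formSig (relForm ω N (p t) (q t)) =
        tripleSig ω (L1 t₀) (L2 t₀) K - formSig (relForm ω N (p t₀) (q t₀)) := by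
  obtain ⟨r, hr⟩ := exists_isProjAlong (hM.isCompl hnd hK hMK)
  have hp₀ := hp.self_of_nhdsWithin ht₀
  have hq₀ := hq.self_of_nhdsWithin ht₀
  have e1 := (hqc.prodMk_nhds (tendsto_const_nhds (x := r))).eventually (eventually_formSig_eq ω N _ _
    (radical_relForm_eq_bot halt hnd hM (h2.lag t₀ ht₀) hK hq₀ hr (inf_comm K _ ▸ hK2) hN))
  have e2 := ((tendsto_const_nhds (x := r)).prodMk_nhds hpc).eventually (eventually_formSig_eq ω N _ _
    (radical_relForm_eq_bot halt hnd hM hK (h1.lag t₀ ht₀) hr hp₀ hK1 hN))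
  filter_upwards [e1, e2, hp, hq, self_mem_nhdsWithin] with t e1 e2 hp hq ht
  rw [tripleSig_eq_add halt hM (h1.lag t ht) (h2.lag t ht) hK hN hp hq hr,
    tripleSig_eq_add halt hM (h1.lag t₀ ht₀) (h2.lag t₀ ht₀) hK hN hp₀ hq₀ hr, e1, e2]
  ring

theorem sum_max_min_sub (f : ℝ → ℤ) (u : ℕ → ℝ) (k : ℕ) (hu : ∀ ν < k, u ν ≤ u (ν + 1)) (t : ℝ)
    (ht : u 0 ≤ t) :
    ∑ ν ∈ Finset.range k, (f (max (u ν) (min t (u (ν + 1)))) - f (u ν)) =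
      f (min t (u k)) - f (u 0) := by
  induction k with
  | zero => simp [min_eq_right ht]
  | succ k ih =>
    rw [Finset.sum_range_succ, ih fun ν hν => hu ν (by lia)]
    have := hu k (by lia)
    rcases le_total t (u k) with h | h
    · rw [min_eq_left h, min_eq_left (h.trans this), max_eq_left h]
      ring
    · rw [min_eq_right h, max_eq_right (le_min h this)]
      ring

namespace AdmissibleData

variable {ω : BilinForm ℝ E} {a b : ℝ} {L1 L2 : ℝ → Submodule ℝ E} (D : AdmissibleData ω a b L1 L2)

/-- The point of the `ν`-th interval of the partition nearest to `t`. -/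
noncomputable def clamp (ν : ℕ) (t : ℝ) : ℝ := max (D.t ν) (min t (D.t (ν + 1)))

/-- The sum of the signatures `s(L1, L2, M_ν)` at the points `D.clamp ν t`. -/
noncomputable def clampSum (t : ℝ) : ℤ :=
  ∑ ν ∈ Finset.range D.k, tripleSig ω (L1 (D.clamp ν t)) (L2 (D.clamp ν t)) (D.M (ν + 1))

theorem t_mono {ν μ : ℕ} (h : ν ≤ μ) (hμ : μ ≤ D.k) : D.t ν ≤ D.t μ := by
  induction μ, h using Nat.le_induction with
  | base => rfl
  | succ μ _ ih => exact (ih (by lia)).trans (D.hmono μ (by lia))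

theorem left_le_t {ν : ℕ} (h : ν ≤ D.k) : a ≤ D.t ν := D.ht0.ge.trans (D.t_mono ν.zero_le h)

theorem t_le_right {ν : ℕ} (h : ν ≤ D.k) : D.t ν ≤ b := (D.t_mono h le_rfl).trans_eq D.htk

theorem clamp_mem {ν : ℕ} (hν : ν < D.k) (t : ℝ) : D.clamp ν t ∈ Set.Icc (D.t ν) (D.t (ν + 1)) :=
  ⟨le_max_left _ _, max_le (D.hmono ν hν) (min_le_right _ _)⟩

theorem clamp_mem_Icc {ν : ℕ} (hν : ν < D.k) (t : ℝ) : D.clamp ν t ∈ Set.Icc a b :=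
  Set.Icc_subset_Icc (D.left_le_t hν.le) (D.t_le_right hν) (D.clamp_mem hν t)

theorem continuous_clamp (ν : ℕ) : Continuous (D.clamp ν) := by
  unfold clamp
  fun_prop

theorem clamp_left {ν : ℕ} (hν : ν < D.k) : D.clamp ν a = D.t ν := by
  rw [clamp, max_eq_left ((min_le_left _ _).trans (D.left_le_t hν.le))]

theorem clamp_right {ν : ℕ} (hν : ν < D.k) : D.clamp ν b = D.t (ν + 1) := by
  rw [clamp, min_eq_right (D.t_le_right hν), max_eq_right (D.hmono ν hν)]

theorem dataSum_eq : dataSum D = (1 / 2 : ℝ) * ((D.clampSum a - D.clampSum b : ℤ) : ℝ) := by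
  rw [dataSum, clampSum, clampSum, ← Finset.sum_sub_distrib]
  push_cast
  congr 1
  refine Finset.sum_congr rfl fun ν hν => ?_
  rw [D.clamp_left (Finset.mem_range.mp hν), D.clamp_right (Finset.mem_range.mp hν)]

/-- Either `t₀` lies in the `ν`-th interval, or the nearest point of it is constant near `t₀`. -/
theorem clamp_eq_self_or_eventually (ν : ℕ) (t₀ : ℝ) :
    D.clamp ν t₀ = t₀ ∨ ∀ᶠ t in 𝓝 t₀, D.clamp ν t = D.clamp ν t₀ := by
  rcases lt_or_ge t₀ (D.t ν) with h | h
  · right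
    filter_upwards [eventually_lt_nhds h] with t ht
    rw [clamp, clamp, max_eq_left ((min_le_left _ _).trans ht.le),
      max_eq_left ((min_le_left _ _).trans h.le)]
  rcases lt_or_ge (D.t (ν + 1)) t₀ with h' | h'
  · right
    filter_upwards [eventually_gt_nhds h'] with t ht
    rw [clamp, clamp, min_eq_right ht.le, min_eq_right h'.le]
  · left
    rw [clamp, min_eq_left h', max_eq_right h]

theorem eventually_clampSum_sub_eq [FiniteDimensional ℝ E] (halt : LinearMap.IsAlt ω)
    (hnd : LinearMap.BilinForm.Nondegenerate ω) (h1 : IsLagrangianPath ω a b L1)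
    (h2 : IsLagrangianPath ω a b L2) {t₀ : ℝ} (ht₀ : t₀ ∈ Set.Icc a b) {M N : Submodule ℝ E}
    (hM : IsLagrangian ω M) (hN : IsCompl M N) (hMD : ∀ ν < D.k, M ⊓ D.M (ν + 1) = ⊥)
    {p q : ℝ → E →L[ℝ] E} (hpc : Tendsto p (𝓝[Set.Icc a b] t₀) (𝓝 (p t₀)))
    (hqc : Tendsto q (𝓝[Set.Icc a b] t₀) (𝓝 (q t₀)))
    (hp : ∀ᶠ t in 𝓝[Set.Icc a b] t₀, IsProjAlong M (L1 t) (p t))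
    (hq : ∀ᶠ t in 𝓝[Set.Icc a b] t₀, IsProjAlong M (L2 t) (q t)) :
    ∀ᶠ t in 𝓝[Set.Icc a b] t₀,
      D.clampSum t - formSig (relForm ω N (p t) (q t)) =
        D.clampSum t₀ - formSig (relForm ω N (p t₀) (q t₀)) := by
  set f : ℝ → ℤ := fun t => formSig (relForm ω N (p t) (q t))
  have hterm : ∀ ν ∈ Finset.range D.k, ∀ᶠ t in 𝓝[Set.Icc a b] t₀,
      tripleSig ω (L1 (D.clamp ν t)) (L2 (D.clamp ν t)) (D.M (ν + 1)) - f (D.clamp ν t) =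
        tripleSig ω (L1 (D.clamp ν t₀)) (L2 (D.clamp ν t₀)) (D.M (ν + 1)) - f (D.clamp ν t₀) := by
    intro ν hν
    rw [Finset.mem_range] at hν
    rcases D.clamp_eq_self_or_eventually ν t₀ with h | h
    · have hmem := D.clamp_mem hν t₀
      rw [h] at hmem
      have hc : Tendsto (D.clamp ν) (𝓝[Set.Icc a b] t₀) (𝓝[Set.Icc a b] t₀) := by
        refine tendsto_nhdsWithin_iff.mpr
          ⟨?_, Eventually.of_forall fun t => D.clamp_mem_Icc hν t⟩
        have := (D.continuous_clamp ν).tendsto t₀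
        rw [h] at this
        exact this.mono_left nhdsWithin_le_nhds
      have := hc.eventually (eventually_tripleSig_sub_eq halt hnd h1 h2 ht₀ hM hN (D.hlag ν hν)
        (hMD ν hν) (D.htrans1 ν hν t₀ hmem) (D.htrans2 ν hν t₀ hmem) hpc hqc hp hq)
      simpa only [h] using this
    · filter_upwards [h.filter_mono nhdsWithin_le_nhds] with t ht
      rw [ht]
  have htele (t : ℝ) (ht : t ∈ Set.Icc a b) :
      ∑ ν ∈ Finset.range D.k, f (D.clamp ν t) =
        f t - f (D.t 0) + ∑ ν ∈ Finset.range D.k, f (D.t ν) := by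
    have := sum_max_min_sub f D.t D.k D.hmono t (D.ht0.le.trans ht.1)
    rw [Finset.sum_sub_distrib, D.htk, min_eq_left ht.2] at this
    exact sub_eq_iff_eq_add.mp this
  filter_upwards [(Finset.range D.k).eventually_all.mpr hterm, self_mem_nhdsWithin] with t ht htI
  have h3 := Finset.sum_congr rfl ht
  rw [Finset.sum_sub_distrib, Finset.sum_sub_distrib, htele t htI, htele t₀ ht₀] at h3
  simp only [clampSum]
  linarith

end AdmissibleData

/-- the triangle identity
`[L1:L2] + [L2:L3] + [L3:L1] = (1/2)( s(L1(a),L2(a),L3(a)) − s(L1(b),L2(b),L3(b)) )`,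
each intersection number being computed from arbitrary admissible data. -/
theorem intersection_number_triangle [FiniteDimensional ℝ E]
    (ω : BilinForm ℝ E) (halt : LinearMap.IsAlt ω)
    (hnd : LinearMap.BilinForm.Nondegenerate ω)
    (a b : ℝ) (hab : a ≤ b)
    (L1 L2 L3 : ℝ → Submodule ℝ E)
    (h1 : IsLagrangianPath ω a b L1) (h2 : IsLagrangianPath ω a b L2)
    (h3 : IsLagrangianPath ω a b L3)
    (D12 : AdmissibleData ω a b L1 L2) (D23 : AdmissibleData ω a b L2 L3)
    (D31 : AdmissibleData ω a b L3 L1) :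
    dataSum D12 + dataSum D23 + dataSum D31 =
      (1 / 2 : ℝ) * ((tripleSig ω (L1 a) (L2 a) (L3 a) : ℝ)
        - (tripleSig ω (L1 b) (L2 b) (L3 b) : ℝ)) := by
  have hloc : ∀ t₀ ∈ Set.Icc a b, ∀ᶠ t in 𝓝[Set.Icc a b] t₀,
      D12.clampSum t + D23.clampSum t + D31.clampSum t - tripleSig ω (L1 t) (L2 t) (L3 t) =
        D12.clampSum t₀ + D23.clampSum t₀ + D31.clampSum t₀ -
          tripleSig ω (L1 t₀) (L2 t₀) (L3 t₀) := by
    intro t₀ ht₀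
    obtain ⟨M, hM, hMS⟩ := exists_isLagrangian_inf_eq_bot halt hnd
      (S := Sum.elim ![L1 t₀, L2 t₀, L3 t₀] (Sum.elim (fun ν : Fin D12.k => D12.M (ν + 1))
        (Sum.elim (fun ν : Fin D23.k => D23.M (ν + 1)) fun ν : Fin D31.k => D31.M (ν + 1)))) (by
        rintro (i | ν | ν | ν)
        · fin_cases i
          exacts [h1.lag t₀ ht₀, h2.lag t₀ ht₀, h3.lag t₀ ht₀]
        exacts [D12.hlag ν ν.2, D23.hlag ν ν.2, D31.hlag ν ν.2])
    have hM1 : M ⊓ L1 t₀ = ⊥ := hMS (.inl 0)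
    have hN := hM.isCompl hnd (h1.lag t₀ ht₀) hM1
    obtain ⟨p, hpc, hp⟩ := h1.exists_isProjAlong hnd ht₀ hM hM1
    obtain ⟨q, hqc, hq⟩ := h2.exists_isProjAlong hnd ht₀ hM (hMS (.inl 1))
    obtain ⟨r, hrc, hr⟩ := h3.exists_isProjAlong hnd ht₀ hM (hMS (.inl 2))
    have hs (t : ℝ) (ht : t ∈ Set.Icc a b) := tripleSig_eq_add halt hM (h1.lag t ht) (h2.lag t ht)
      (h3.lag t ht) hN (p := p t) (q := q t) (r := r t)
    filter_upwards [hp, hq, hr, self_mem_nhdsWithin,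
      D12.eventually_clampSum_sub_eq halt hnd h1 h2 ht₀ hM hN
        (fun ν hν => hMS (.inr (.inl ⟨ν, hν⟩))) hpc hqc hp hq,
      D23.eventually_clampSum_sub_eq halt hnd h2 h3 ht₀ hM hN
        (fun ν hν => hMS (.inr (.inr (.inl ⟨ν, hν⟩)))) hqc hrc hq hr,
      D31.eventually_clampSum_sub_eq halt hnd h3 h1 ht₀ hM hN
        (fun ν hν => hMS (.inr (.inr (.inr ⟨ν, hν⟩)))) hrc hpc hr hp] with t hpt hqt hrt ht e1 e2 e3
    rw [hs t ht hpt hqt hrt, hs t₀ ht₀ (hp.self_of_nhdsWithin ht₀) (hq.self_of_nhdsWithin ht₀)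
      (hr.self_of_nhdsWithin ht₀)]
    linarith
  have hconst := isPreconnected_Icc.constant (Y := ℤ) (s := Set.Icc a b)
    (f := fun t => D12.clampSum t + D23.clampSum t + D31.clampSum t -
      tripleSig ω (L1 t) (L2 t) (L3 t))
    (fun t ht => tendsto_nhds_of_eventually_eq (hloc t ht))
    (Set.left_mem_Icc.mpr hab) (Set.right_mem_Icc.mpr hab)
  have hconst' := congrArg (Int.cast : ℤ → ℝ) hconst
  rw [D12.dataSum_eq, D23.dataSum_eq, D31.dataSum_eq]
  push_cast at hconst' ⊢
  linarith
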